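/- For all 0 < q < 1, 0 < a < 1, 0 < b < 1 and all n, x ∈ ℕ, the infinite series ∑_{k=max(n,x)}^{∞} q^{(k−x)(k−x−1)/2} (−a)^{k−x} · [(abq^{n+k};q)_∞ (b;q)_k / ((a;q)_∞ (b;q)_x (q;q)_k)] · ∏_{j=0}^{n−1}(1−q^{k−j}) · ∏_{j=0}^{x−1}(1−q^{k−j}) converges and equals the little q-Jacobi function p_n^{a,b;q}(x). -/

import Mathlib

open Finset

/-- The q-Pochhammer symbol `(c;q)_k = ∏_{j=0}^{k-1} (1 - c q^j)`. -/
noncomputable def qPoch (q c : ℝ) (k : ℕ) : ℝ := ∏ j ∈ Finset.range k, (1 - c * q ^ j)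

/-- The little q-Jacobi function
`p_n^{a,b;q}(x) = ∑_{k=0}^{n} [(q^{−n};q)_k (a b q^{n−1};q)_k / ((a;q)_k (q;q)_k)] q^{k(x+1)}`. -/
noncomputable def littleqJacobi (a b q : ℝ) (n x : ℕ) : ℝ :=
  ∑ k ∈ Finset.range (n + 1),
    qPoch q (q ^ (-(n : ℤ))) k * qPoch q (a * b * q ^ ((n : ℤ) - 1)) k
      / (qPoch q a k * qPoch q q k) * q ^ (k * (x + 1))

/-- The `k`-th term of the upper-times-lower series representation of
little q-Jacobi functions. -/
noncomputable def ULterm (a b q : ℝ) (n x k : ℕ) : ℝ :=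
  q ^ ((k - x) * (k - x - 1) / 2) * (-a) ^ (k - x) *
    ((∏' j : ℕ, (1 - a * b * q ^ (n + k + j))) * qPoch q b k /
      ((∏' j : ℕ, (1 - a * q ^ j)) * qPoch q b x * qPoch q q k)) *
    (∏ j ∈ Finset.range n, (1 - q ^ (k - j))) *
    (∏ j ∈ Finset.range x, (1 - q ^ (k - j)))


/-- `∏_{j<k} (1 - q^{n-j})` with truncated subtraction. -/
noncomputable def fallP (q : ℝ) (n k : ℕ) : ℝ := ∏ j ∈ Finset.range k, (1 - q ^ (n - j))

lemma fallP_succ (q : ℝ) (n k : ℕ) : fallP q n (k+1) = fallP q n k * (1 - q ^ (n - k)) := by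
  simp [fallP, Finset.prod_range_succ]

lemma fallP_succ_succ (q : ℝ) (n k : ℕ) :
    fallP q (n+1) (k+1) = (1 - q ^ (n+1)) * fallP q n k := by
  simp [fallP, Finset.prod_range_succ', mul_comm]

lemma fallP_zero_of_lt (q : ℝ) {n k : ℕ} (h : n < k) : fallP q n k = 0 :=
  Finset.prod_eq_zero (Finset.mem_range.2 h) (by simp)

lemma qPoch_succ (q c : ℝ) (k : ℕ) : qPoch q c (k+1) = qPoch q c k * (1 - c * q ^ k) := by
  simp [qPoch, Finset.prod_range_succ]

lemma qPoch_succ' (q c : ℝ) (k : ℕ) : qPoch q c (k+1) = (1 - c) * qPoch q (c * q) k := by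
  simp only [qPoch, Finset.prod_range_succ']
  rw [mul_comm]
  congr 1
  · simp
  · refine Finset.prod_congr rfl fun j _ => ?_
    ring

lemma qPoch_add (q c : ℝ) (m k : ℕ) :
    qPoch q c (m+k) = qPoch q c m * qPoch q (c * q ^ m) k := by
  simp only [qPoch, Finset.prod_range_add]
  congr 1
  refine Finset.prod_congr rfl fun j _ => ?_
  ring

lemma qPoch_pos {q c : ℝ} (hq0 : 0 < q) (hq1 : q < 1) (hc1 : c < 1) (hc0 : 0 ≤ c) (k : ℕ) :
    0 < qPoch q c k := by
  refine Finset.prod_pos fun j _ => ?_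
  have := mul_le_mul_of_nonneg_left (pow_le_one₀ hq0.le hq1.le : q ^ j ≤ 1) hc0
  linarith

lemma qPoch_le_one {q c : ℝ} (hq0 : 0 < q) (hq1 : q < 1) (hc1 : c < 1) (hc0 : 0 ≤ c) (k : ℕ) :
    qPoch q c k ≤ 1 := by
  refine Finset.prod_le_one (fun j _ => ?_) (fun j _ => ?_)
  · have := mul_le_mul_of_nonneg_left (pow_le_one₀ hq0.le hq1.le : q ^ j ≤ 1) hc0
    linarith
  · have : 0 ≤ c * q ^ j := by positivity
    linarith

lemma fallP_mem {q : ℝ} (hq0 : 0 < q) (hq1 : q < 1) (n k : ℕ) :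
    0 ≤ fallP q n k ∧ fallP q n k ≤ 1 := by
  have h : ∀ j, q ^ (n - j) ≤ 1 := fun j => pow_le_one₀ hq0.le hq1.le
  have h' : ∀ j, 0 ≤ q ^ (n - j) := fun j => by positivity
  exact ⟨Finset.prod_nonneg fun j _ => by linarith [h j],
    Finset.prod_le_one (fun j _ => by linarith [h j]) (fun j _ => by linarith [h' j])⟩

/-- Term of the finite identity. -/
noncomputable def finT (q α z : ℝ) (n k : ℕ) : ℝ :=
  fallP q n k / qPoch q q k * (-1) ^ k * q ^ (k.choose 2) * z ^ k * qPoch q α k *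
    qPoch q (α * z * q ^ k) (n - k)

lemma gauss_pascal {q : ℝ} (hq0 : 0 < q) (hq1 : q < 1) (n k : ℕ) :
    fallP q (n+1) (k+1) / qPoch q q (k+1) =
      q ^ (k+1) * (fallP q n (k+1) / qPoch q q (k+1)) + fallP q n k / qPoch q q k := by
  have h1 := (qPoch_pos hq0 hq1 hq1 hq0.le k).ne'
  have h2 := (qPoch_pos hq0 hq1 hq1 hq0.le (k+1)).ne'
  have h3 : (1 - q * q ^ k) ≠ 0 := by
    intro h; rw [qPoch_succ, h] at h2; simp at h2
  rw [fallP_succ_succ, fallP_succ, qPoch_succ]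
  rcases le_or_gt k n with h | h
  · obtain ⟨d, rfl⟩ := Nat.exists_eq_add_of_le h
    simp only [Nat.add_sub_cancel_left]
    field_simp
    ring
  · simp [fallP_zero_of_lt q h]

lemma fin_identity {q : ℝ} (hq0 : 0 < q) (hq1 : q < 1) (α : ℝ) (n : ℕ) : ∀ z : ℝ,
    ∑ k ∈ Finset.range (n+1), finT q α z n k = qPoch q z n := by
  induction n with
  | zero => intro z; simp [finT, fallP, qPoch]
  | succ n ih =>
    intro z
    rw [qPoch_succ', ← ih (z * q), Finset.mul_sum]
    -- first part and second part
    let A : ℕ → ℝ := fun k => (1 - α * z * q ^ k) * finT q α (z * q) n k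
    let B : ℕ → ℝ := fun k => - z * (1 - α * q ^ k) * finT q α (z * q) n k
    have h0 : finT q α z (n+1) 0 = A 0 := by
      simp [A, finT, fallP, qPoch_succ']
      simp [qPoch, mul_assoc]
    have hs : ∀ k ∈ Finset.range (n+1), finT q α z (n+1) (k+1) = A (k+1) + B k := by
      intro k hk
      have hk' : k ≤ n := by simpa [Nat.lt_succ_iff] using hk
      have e1 : n + 1 - (k+1) = n - k := by omega
      have e2 : (k+1).choose 2 = k.choose 2 + k := by
        rw [Nat.choose_succ_succ' k 1]; simp [add_comm]
      have e3 : α * (z * q) * q ^ k = α * z * q ^ (k+1) := by ring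
      have hA : A (k+1) = q ^ (k+1) * (fallP q n (k+1) / qPoch q q (k+1)) * (-1) ^ (k+1)
          * q ^ ((k+1).choose 2) * z ^ (k+1) * qPoch q α (k+1)
          * qPoch q (α * z * q ^ (k+1)) (n - k) := by
        rcases Nat.lt_or_ge k n with h | h
        · have e4 : n - k = (n - (k+1)) + 1 := by omega
          rw [e4, qPoch_succ' q (α * z * q ^ (k+1))]
          simp only [A, finT]
          have e5 : α * (z * q) * q ^ (k+1) = α * z * q ^ (k+1) * q := by ring
          rw [e5, mul_pow z q]
          ring
        · simp [A, finT, fallP_zero_of_lt q (show n < k + 1 by omega)]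
      rw [hA]
      simp only [B, finT]
      rw [gauss_pascal hq0 hq1, e1, e2, e3, qPoch_succ q α k]
      ring
    rw [Finset.sum_range_succ', Finset.sum_congr rfl hs, h0, Finset.sum_add_distrib]
    have hlast : A (n+1) = 0 := by
      simp [A, finT, fallP_zero_of_lt q (show n < n + 1 by omega)]
    have : ∑ k ∈ Finset.range (n+1), A (k+1) + A 0 = ∑ k ∈ Finset.range (n+1), A k := by
      rw [← Finset.sum_range_succ' A (n+1), Finset.sum_range_succ, hlast, add_zero]
    rw [add_right_comm, this, ← Finset.sum_add_distrib]
    refine Finset.sum_congr rfl fun k _ => ?_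
    simp only [A, B]
    ring

open Filter Topology

/-- The infinite q-Pochhammer symbol. -/
noncomputable def qInf (q c : ℝ) : ℝ := ∏' j : ℕ, (1 - c * q ^ j)

lemma summable_aux {q : ℝ} (hq0 : 0 < q) (hq1 : q < 1) (c : ℝ) :
    Summable fun j : ℕ => ‖-(c * q ^ j)‖ := by
  have := (summable_geometric_of_lt_one hq0.le hq1).mul_left |c|
  refine this.congr fun j => ?_
  rw [norm_neg, Real.norm_eq_abs, abs_mul, abs_of_pos (pow_pos hq0 j)]

lemma multipliable_aux {q : ℝ} (hq0 : 0 < q) (hq1 : q < 1) (c : ℝ) :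
    Multipliable fun j : ℕ => (1 - c * q ^ j) := by
  simpa [sub_eq_add_neg] using multipliable_one_add_of_summable (summable_aux hq0 hq1 c)

lemma tendsto_qPoch {q : ℝ} (hq0 : 0 < q) (hq1 : q < 1) (c : ℝ) :
    Tendsto (fun n => qPoch q c n) atTop (𝓝 (qInf q c)) :=
  (multipliable_aux hq0 hq1 c).tendsto_prod_tprod_nat

lemma qInf_split {q : ℝ} (hq0 : 0 < q) (hq1 : q < 1) (c : ℝ) (m : ℕ) :
    qInf q c = qPoch q c m * qInf q (c * q ^ m) := by
  have h1 : Tendsto (fun n => qPoch q c (m + n)) atTop (𝓝 (qInf q c)) := by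
    have := (tendsto_qPoch hq0 hq1 c).comp (tendsto_add_atTop_nat m)
    refine this.congr fun n => ?_
    simp [add_comm]
  have h2 := (tendsto_qPoch hq0 hq1 (c * q ^ m)).const_mul (qPoch q c m)
  refine tendsto_nhds_unique h1 (h2.congr fun n => ?_)
  rw [qPoch_add]

lemma qInf_ne_zero {q c : ℝ} (hq0 : 0 < q) (hq1 : q < 1) (hc0 : 0 ≤ c) (hc1 : c < 1) :
    qInf q c ≠ 0 := by
  have := tprod_one_add_ne_zero_of_summable (f := fun j : ℕ => -(c * q ^ j)) (fun j => ?_)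
    (summable_aux hq0 hq1 c)
  · simpa [qInf, sub_eq_add_neg] using this
  · have := mul_le_mul_of_nonneg_left (pow_le_one₀ hq0.le hq1.le : q ^ j ≤ 1) hc0
    have : 0 < 1 + -(c * q ^ j) := by linarith
    exact this.ne'

lemma tendsto_fallP {q : ℝ} (hq0 : 0 < q) (hq1 : q < 1) (k : ℕ) :
    Tendsto (fun n => fallP q n k) atTop (𝓝 1) := by
  have : Tendsto (fun n => ∏ j ∈ Finset.range k, (1 - q ^ (n - j))) atTop
      (𝓝 (∏ j ∈ Finset.range k, (1 - 0))) := by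
    refine tendsto_finsetProd _ fun j _ => ?_
    exact ((tendsto_pow_atTop_nhds_zero_of_lt_one hq0.le hq1).comp
      (tendsto_sub_atTop_nat j)).const_sub 1
  simpa [fallP] using this

/-- Term of the infinite identity. -/
noncomputable def infT (q α z : ℝ) (k : ℕ) : ℝ :=
  1 / qPoch q q k * (-1) ^ k * q ^ (k.choose 2) * z ^ k * qPoch q α k *
    qInf q (α * z * q ^ k)

lemma choose_two_succ (k : ℕ) : (k+1).choose 2 = k.choose 2 + k := by
  rw [Nat.choose_succ_succ' k 1]; simp [add_comm]

lemma summable_bound {q z : ℝ} (hq0 : 0 < q) (hq1 : q < 1) (hz0 : 0 < z) :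
    Summable fun k : ℕ => 1 / qPoch q q k * q ^ (k.choose 2) * z ^ k := by
  have hp := qPoch_pos hq0 hq1 hq1 hq0.le
  have hpos : ∀ k : ℕ, 0 < 1 / qPoch q q k * q ^ (k.choose 2) * z ^ k := fun k => by
    have := hp k
    positivity
  refine summable_of_ratio_test_tendsto_lt_one (l := 0) one_pos
    (Eventually.of_forall fun k => (hpos k).ne') ?_
  have h0 := tendsto_pow_atTop_nhds_zero_of_lt_one hq0.le hq1
  have h : Tendsto (fun k : ℕ => q ^ k * z / (1 - q * q ^ k)) atTop
      (𝓝 (0 * z / (1 - q * 0))) :=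
    (h0.mul_const z).div ((h0.const_mul q).const_sub 1) (by simp)
  rw [zero_mul, zero_div] at h
  refine h.congr fun k => ?_
  rw [Real.norm_of_nonneg (hpos k).le, Real.norm_of_nonneg (hpos (k+1)).le]
  have h1 := (hp k).ne'
  have h2 := (hp (k+1)).ne'
  rw [qPoch_succ] at h2 ⊢
  have h3 := right_ne_zero_of_mul h2
  rw [choose_two_succ]
  field_simp
  ring

lemma hasSum_infT {q α z : ℝ} (hq0 : 0 < q) (hq1 : q < 1) (hz0 : 0 < z) (hz1 : z < 1)
    (hα0 : 0 ≤ α) (hα1 : α < 1) : HasSum (infT q α z) (qInf q z) := by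
  have hp := qPoch_pos hq0 hq1 hq1 hq0.le
  have hb := summable_bound hq0 hq1 hz0
  have hbd : ∀ n k, ‖finT q α z n k‖ ≤ 1 / qPoch q q k * q ^ (k.choose 2) * z ^ k := by
    intro n k
    have hf := fallP_mem hq0 hq1 n k
    have hA0 := qPoch_pos hq0 hq1 hα1 hα0 k
    have hA1 := qPoch_le_one hq0 hq1 hα1 hα0 k
    have hc0 : 0 ≤ α * z * q ^ k := by positivity
    have hc1 : α * z * q ^ k < 1 := by
      have h1 : q ^ k ≤ 1 := pow_le_one₀ hq0.le hq1.le
      have h2 : α * z ≤ z := by nlinarith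
      have h3 : α * z * q ^ k ≤ α * z := mul_le_of_le_one_right (by positivity) h1
      linarith
    have hB0 := qPoch_pos hq0 hq1 hc1 hc0 (n - k)
    have hB1 := qPoch_le_one hq0 hq1 hc1 hc0 (n - k)
    have hpk := hp k
    have e : finT q α z n k = (-1) ^ k * ((1 / qPoch q q k * q ^ (k.choose 2) * z ^ k) *
        (fallP q n k * (qPoch q α k * qPoch q (α * z * q ^ k) (n - k)))) := by
      simp only [finT]; ring
    have hprod0 : 0 ≤ fallP q n k * (qPoch q α k * qPoch q (α * z * q ^ k) (n - k)) :=
      mul_nonneg hf.1 (mul_pos hA0 hB0).le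
    have hprod1 : fallP q n k * (qPoch q α k * qPoch q (α * z * q ^ k) (n - k)) ≤ 1 :=
      mul_le_one₀ hf.2 (mul_pos hA0 hB0).le (mul_le_one₀ hA1 hB0.le hB1)
    rw [e, norm_mul, norm_pow, norm_neg, norm_one, one_pow, one_mul,
      Real.norm_of_nonneg (by positivity)]
    exact mul_le_of_le_one_right (by positivity) hprod1
  have hlim : ∀ k, Tendsto (fun n => finT q α z n k) atTop (𝓝 (infT q α z k)) := by
    intro k
    have h2 : Tendsto (fun n => qPoch q (α * z * q ^ k) (n - k)) atTop
        (𝓝 (qInf q (α * z * q ^ k))) :=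
      (tendsto_qPoch hq0 hq1 _).comp (tendsto_sub_atTop_nat k)
    exact ((((((tendsto_fallP hq0 hq1 k).div_const _).mul_const _).mul_const _).mul_const
      _).mul_const _).mul h2
  have hs : Summable (infT q α z) := by
    refine Summable.of_norm_bounded hb fun k => ?_
    exact le_of_tendsto (hlim k).norm (Eventually.of_forall fun n => hbd n k)
  have h := tendsto_tsum_of_dominated_convergence hb hlim (Eventually.of_forall hbd)
  have h' : ∀ n, ∑' k, finT q α z n k = qPoch q z n := by
    intro n
    rw [← fin_identity hq0 hq1 α n z]
    refine tsum_eq_sum fun k hk => ?_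
    have : n < k := by simpa using hk
    simp [finT, fallP_zero_of_lt q this]
  simp only [h'] at h
  rw [tendsto_nhds_unique (tendsto_qPoch hq0 hq1 z) h]
  exact hs.hasSum

lemma qPoch_neg_pow {q : ℝ} (hq0 : 0 < q) (n k : ℕ) (h : k ≤ n) :
    qPoch q (q ^ (-(n : ℤ))) k * q ^ (n * k) = (-1) ^ k * q ^ (k.choose 2) * fallP q n k := by
  induction k with
  | zero => simp [qPoch, fallP]
  | succ k ih =>
    have ih := ih (by omega)
    rw [qPoch_succ, fallP_succ, choose_two_succ]
    obtain ⟨d, rfl⟩ := Nat.exists_eq_add_of_le (show k ≤ n by omega)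
    have e : (1 - q ^ (-((k + d : ℕ) : ℤ)) * q ^ k) * q ^ (k + d) =
        - q ^ k * (1 - q ^ d) := by
      rw [zpow_neg, zpow_natCast]
      field_simp
      ring
    rw [Nat.add_sub_cancel_left]
    calc _ = (qPoch q (q ^ (-((k + d : ℕ) : ℤ))) k * q ^ ((k + d) * k)) *
          ((1 - q ^ (-((k + d : ℕ) : ℤ)) * q ^ k) * q ^ (k + d)) := by ring
      _ = _ := by rw [ih, e]; ring

lemma fallP_eq_qPoch {q : ℝ} (hq0 : 0 < q) (K n : ℕ) :
    qPoch q (q ^ K * q ^ (1 - (n : ℤ))) n = fallP q K n := by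
  have h1 : qPoch q (q ^ K * q ^ (1 - (n : ℤ))) n =
      ∏ j ∈ Finset.range n, (1 - q ^ ((K : ℤ) - j)) := by
    rw [← Finset.prod_range_reflect, qPoch]
    refine Finset.prod_congr rfl fun j hj => ?_
    have hj : j < n := by simpa using hj
    congr 1
    rw [← zpow_natCast, ← zpow_natCast, ← zpow_add₀ hq0.ne', ← zpow_add₀ hq0.ne']
    congr 1
    omega
  rw [h1]
  rcases le_or_gt n K with h | h
  · refine Finset.prod_congr rfl fun j hj => ?_
    have hj : j < n := by simpa using hj
    rw [← zpow_natCast, Nat.cast_sub (by omega)]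
  · rw [fallP_zero_of_lt q h]
    exact Finset.prod_eq_zero (Finset.mem_range.2 h) (by simp)

lemma fallP_mul_qPoch (q : ℝ) (x m : ℕ) :
    qPoch q q (x + m) = fallP q (x + m) x * qPoch q q m := by
  induction x with
  | zero => simp [fallP]
  | succ x ih =>
    rw [show x + 1 + m = (x + m) + 1 by ring, fallP_succ_succ, qPoch_succ, ih]
    ring

lemma ULterm_eq {q a b : ℝ} (hq0 : 0 < q) (hq1 : q < 1)
    (ha0 : 0 < a) (ha1 : a < 1) (hb0 : 0 < b) (hb1 : b < 1) (n x m : ℕ) :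
    ULterm a b q n x (x + m) =
      ∑ k ∈ Finset.range (n + 1),
        (qPoch q (q ^ (-(n : ℤ))) k * qPoch q (a * b * q ^ ((n : ℤ) - 1)) k
          / (qPoch q q k) * q ^ (k * (x + 1)) / qInf q a) *
          infT q (b * q ^ x) (a * q ^ k) m := by
  have hp := fun k => (qPoch_pos hq0 hq1 hq1 hq0.le k).ne'
  have hbx := (qPoch_pos hq0 hq1 hb1 hb0.le x).ne'
  have hE := qInf_ne_zero hq0 hq1 ha0.le ha1
  set α := a * b * q ^ ((n : ℤ) - 1) with hα
  set z := q ^ (x + m) * q ^ (1 - (n : ℤ)) with hz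
  have hαz : α * z = a * b * q ^ (x + m) := by
    rw [hα, hz]
    have : q ^ ((n : ℤ) - 1) * q ^ (1 - (n : ℤ)) = 1 := by
      rw [← zpow_add₀ hq0.ne']; simp
    linear_combination (a * b * q ^ (x+m)) * this
  have key := fin_identity hq0 hq1 α n z
  rw [fallP_eq_qPoch hq0] at key
  have hf : fallP q (x + m) x ≠ 0 := by
    have := hp (x + m)
    rw [fallP_mul_qPoch] at this
    exact left_ne_zero_of_mul this
  have htp : (∏' j : ℕ, (1 - a * b * q ^ (n + (x + m) + j))) =
      qInf q (a * b * q ^ (x + m) * q ^ n) := by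
    refine tprod_congr fun j => ?_
    ring
  have hL : ULterm a b q n x (x + m) = q ^ (m.choose 2) * (-a) ^ m *
      qInf q (a * b * q ^ (x + m) * q ^ n) / qInf q a * qPoch q (b * q ^ x) m / qPoch q q m *
      fallP q (x + m) n := by
    unfold ULterm
    rw [htp, Nat.add_sub_cancel_left, ← Nat.choose_two_right, qPoch_add q b, fallP_mul_qPoch]
    change _ * (_ / (qInf q a * _ * _)) * fallP q (x + m) n * fallP q (x + m) x = _
    have := hp m
    field_simp
  rw [hL, ← key, Finset.mul_sum]
  refine Finset.sum_congr rfl fun k hk => ?_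
  have hk : k ≤ n := by simpa [Nat.lt_succ_iff] using hk
  have hsplit := qInf_split hq0 hq1 (a * b * q ^ (x + m) * q ^ k) (n - k)
  rw [mul_assoc _ (q ^ k), ← pow_add, Nat.add_sub_cancel' hk] at hsplit
  have hneg := qPoch_neg_pow hq0 n k hk
  have hzk : z ^ k * q ^ (n * k) = q ^ (k * (x + 1)) * q ^ (k * m) := by
    have : z * q ^ n = q ^ (x + 1) * q ^ m := by
      rw [hz, mul_assoc, ← zpow_natCast q n, ← zpow_add₀ hq0.ne']
      simp
      ring
    rw [pow_mul, ← mul_pow, this]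
    ring
  have harg : b * q ^ x * (a * q ^ k) * q ^ m = a * b * q ^ (x + m) * q ^ k := by ring
  simp only [finT, infT]
  rw [hαz, harg, hsplit]
  have hqn : q ^ (n * k) ≠ 0 := by positivity
  have hzk' : q ^ (k * (x + 1)) * q ^ (k * m) *  qPoch q (q ^ (-(n : ℤ))) k =
      (-1) ^ k * q ^ (k.choose 2) * fallP q n k * z ^ k := by
    rw [← hzk, ← hneg]; ring
  have e1 : (a * q ^ k) ^ m = a ^ m * q ^ (k * m) := by ring
  have e2 : (-a) ^ m = (-1) ^ m * a ^ m := by rw [← mul_pow]; simp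
  rw [e1, e2]
  linear_combination (-(qPoch q α k / qPoch q q k / qInf q a * (1 / qPoch q q m * (-1) ^ m *
    q ^ (m.choose 2) * a ^ m * qPoch q (b * q ^ x) m *
    (qPoch q (a * b * q ^ (x + m) * q ^ k) (n - k) *
      qInf q (a * b * q ^ (x + m) * q ^ n))))) * hzk'

theorem littleqJacobi_UL_series (q a b : ℝ) (hq0 : 0 < q) (hq1 : q < 1)
    (ha0 : 0 < a) (ha1 : a < 1) (hb0 : 0 < b) (hb1 : b < 1) (n x : ℕ) :
    HasSum (fun i : ℕ => ULterm a b q n x (max n x + i)) (littleqJacobi a b q n x) := by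
  have hE := qInf_ne_zero hq0 hq1 ha0.le ha1
  have hmain : HasSum (fun m => ULterm a b q n x (x + m)) (littleqJacobi a b q n x) := by
    simp only [ULterm_eq hq0 hq1 ha0 ha1 hb0 hb1]
    unfold littleqJacobi
    refine hasSum_sum fun k _ => ?_
    have hk1 : q ^ k ≤ 1 := pow_le_one₀ hq0.le hq1.le
    have hx1 : q ^ x ≤ 1 := pow_le_one₀ hq0.le hq1.le
    have h := (hasSum_infT (α := b * q ^ x) (z := a * q ^ k) hq0 hq1 (by positivity)
      ((mul_le_of_le_one_right ha0.le hk1).trans_lt ha1) (by positivity)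
      ((mul_le_of_le_one_right hb0.le hx1).trans_lt hb1)).mul_left
      (qPoch q (q ^ (-(n : ℤ))) k * qPoch q (a * b * q ^ ((n : ℤ) - 1)) k
          / (qPoch q q k) * q ^ (k * (x + 1)) / qInf q a)
    refine (congrArg (HasSum _) ?_).mpr h
    have hs := qInf_split hq0 hq1 a k
    have h1 := (qPoch_pos hq0 hq1 hq1 hq0.le k).ne'
    have h2 := (qPoch_pos hq0 hq1 ha1 ha0.le k).ne'
    rw [hs] at hE ⊢
    have h3 := right_ne_zero_of_mul hE
    field_simp
  have hmax : x ≤ max n x := le_max_right _ _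
  have h := (hasSum_nat_add_iff' (max n x - x)).2 hmain
  rw [Finset.sum_eq_zero, sub_zero] at h
  · refine h.congr_fun ?_
    intro i
    congr 1
    omega
  · intro i hi
    have hi : i < max n x - x := by simpa using hi
    have : x + i < n := by omega
    have h0 := fallP_zero_of_lt q this
    unfold fallP at h0
    simp [ULterm, h0]
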